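/- Let L be a domain and let E be a topological space. Every L-valued maxitive measure on the Borel σ-algebra ℬ of E that is both weakly outer-continuous and weakly inner-continuous is regular and completely maxitive. -/

import Mathlib

open Set

universe u v

section OrderDefs
variable {L : Type u} [PartialOrder L]

/-- A filtered (nonempty, downward directed) subset of a poset. -/
def DirFiltered (F : Set L) : Prop :=
  F.Nonempty ∧ ∀ r ∈ F, ∀ s ∈ F, ∃ t ∈ F, t ≤ r ∧ t ≤ s

/-- A filter of a poset: a filtered upper set. -/
def OrdFilter (F : Set L) : Prop :=
  DirFiltered F ∧ ∀ r ∈ F, ∀ s : L, r ≤ s → s ∈ F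

/-- Every filter has an infimum. -/
def FilteredComplete (L : Type u) [PartialOrder L] : Prop :=
  ∀ F : Set L, OrdFilter F → ∃ i : L, IsGLB F i

/-- `s` is way-above `r`: for every filter `F` with an infimum below `r`, `s ∈ F`. -/
def WayAbove (s r : L) : Prop :=
  ∀ F : Set L, OrdFilter F → ∀ i : L, IsGLB F i → i ≤ r → s ∈ F

/-- The poset is continuous: for every `r`, the set of elements way-above `r`
is a filter whose infimum is `r`. -/
def ContinuousPoset (L : Type u) [PartialOrder L] : Prop :=
  ∀ r : L, OrdFilter {s : L | WayAbove s r} ∧ IsGLB {s : L | WayAbove s r} r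

/-- Conditional completeness: every nonempty set bounded above has a supremum. -/
def CondComplete (L : Type u) [PartialOrder L] : Prop :=
  ∀ S : Set L, S.Nonempty → BddAbove S → ∃ m : L, IsLUB S m

end OrderDefs

/-- A domain: a filtered-complete continuous poset with a least element. -/
def DomainPoset (L : Type u) [PartialOrder L] [OrderBot L] : Prop :=
  FilteredComplete L ∧ ContinuousPoset L

section TopDefs
variable {E : Type v} [TopologicalSpace E]

/-- The saturation of a set: intersection of all open sets containing it. -/
def satur (A : Set E) : Set E := ⋂₀ {G : Set E | IsOpen G ∧ A ⊆ G}

/-- A set is saturated if it is an intersection of open sets. -/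
def IsSatur (A : Set E) : Prop :=
  ∃ 𝒢 : Set (Set E), (∀ G ∈ 𝒢, IsOpen G) ∧ A = ⋂₀ 𝒢

/-- The collection 𝒬 of compact saturated subsets. -/
def CompactSat (E : Type v) [TopologicalSpace E] : Set (Set E) :=
  {A : Set E | IsCompact A ∧ IsSatur A}

/-- The Borel σ-algebra generated by open sets and compact saturated sets. -/
def BorelM (E : Type v) [TopologicalSpace E] : MeasurableSpace E :=
  MeasurableSpace.generateFrom ({A : Set E | IsOpen A} ∪ CompactSat E)

/-- Borel subsets for the σ-algebra generated by opens and compact saturated sets. -/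
def IsBorelSet (B : Set E) : Prop := @MeasurableSet E (BorelM E) B

/-- The collection 𝒦 of compact Borel subsets. -/
def CompactBorel (E : Type v) [TopologicalSpace E] : Set (Set E) :=
  {A : Set E | IsBorelSet A ∧ IsCompact A}

/-- `[x]` : the compact Borel set `↑{x} ∩ closure {x}`. -/
def ptClass (x : E) : Set E := satur {x} ∩ closure {x}

end TopDefs

section MeasDefs
variable {L : Type u} {E : Type v} [PartialOrder L] [OrderBot L] [TopologicalSpace E]

/-- An L-valued maxitive measure on the Borel σ-algebra. -/
def Maxitive (ν : Set E → L) : Prop :=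
  ν ∅ = ⊥ ∧ ∀ 𝒞 : Set (Set E), 𝒞.Finite → (∀ B ∈ 𝒞, IsBorelSet B) →
    IsLUB (ν '' 𝒞) (ν (⋃₀ 𝒞))

/-- σ-maxitivity. -/
def SigmaMaxitive (ν : Set E → L) : Prop :=
  Maxitive ν ∧ ∀ 𝒞 : Set (Set E), 𝒞.Countable → (∀ B ∈ 𝒞, IsBorelSet B) →
    IsLUB (ν '' 𝒞) (ν (⋃₀ 𝒞))

/-- Complete maxitivity. -/
def CompletelyMaxitive (ν : Set E → L) : Prop :=
  Maxitive ν ∧ ∀ 𝒞 : Set (Set E), (∀ B ∈ 𝒞, IsBorelSet B) → IsBorelSet (⋃₀ 𝒞) →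
    IsLUB (ν '' 𝒞) (ν (⋃₀ 𝒞))

/-- The set `{ν G : G open, G ⊇ B}`. -/
def outerVals (ν : Set E → L) (B : Set E) : Set L :=
  {l : L | ∃ G : Set E, IsOpen G ∧ B ⊆ G ∧ ν G = l}

/-- `νp` is the map `ν⁺ : B ↦ inf {ν G : G open, G ⊇ B}` on Borel sets. -/
def IsNuPlus (ν νp : Set E → L) : Prop :=
  ∀ B : Set E, IsBorelSet B → IsGLB (outerVals ν B) (νp B)

/-- Outer-continuity. -/
def OuterContinuous (ν : Set E → L) : Prop :=
  ∀ B : Set E, IsBorelSet B → IsGLB (outerVals ν B) (ν B)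

/-- Inner-continuity. -/
def InnerContinuous (ν : Set E → L) : Prop :=
  ∀ B : Set E, IsBorelSet B →
    IsLUB {l : L | ∃ K : Set E, IsBorelSet K ∧ IsCompact K ∧ K ⊆ B ∧ ν (satur K) = l} (ν B)

/-- Regularity: inner- and outer-continuity. -/
def RegularMeasure (ν : Set E → L) : Prop :=
  InnerContinuous ν ∧ OuterContinuous ν

/-- Weak outer-continuity: `ν K = ν⁺ K` for every compact Borel `K`. -/
def WeaklyOuterContinuous (ν : Set E → L) : Prop :=
  ∀ K : Set E, IsBorelSet K → IsCompact K → IsGLB (outerVals ν K) (ν K)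

/-- Weak inner-continuity (relative to a given `ν⁺ = νp`). -/
def WeaklyInnerContinuous (ν νp : Set E → L) : Prop :=
  ∀ G : Set E, IsOpen G →
    IsLUB {l : L | ∃ K : Set E, IsBorelSet K ∧ IsCompact K ∧ K ⊆ G ∧ νp K = l} (ν G)

/-- 𝒜-smoothness. -/
def SmoothWrt (ν : Set E → L) (𝒜 : Set (Set E)) : Prop :=
  ∀ 𝒟 : Set (Set E), 𝒟.Nonempty → 𝒟 ⊆ 𝒜 → DirectedOn (· ⊇ ·) 𝒟 →
    IsGLB (ν '' 𝒟) (ν (⋂₀ 𝒟))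

/-- Saturation of a maxitive measure: `ν K = ν (↑K)` for compact Borel `K`. -/
def SaturatedMeasure (ν : Set E → L) : Prop :=
  ∀ K : Set E, IsBorelSet K → IsCompact K → ν K = ν (satur K)

/-- Tightness: `inf {ν (E ∖ K) : K compact Borel} = 0`. -/
def TightMeasure (ν : Set E → L) : Prop :=
  IsGLB {l : L | ∃ K : Set E, IsBorelSet K ∧ IsCompact K ∧ ν Kᶜ = l} (⊥ : L)

/-- `c` is a cardinal density of `ν`. -/
def IsCardinalDensity (ν : Set E → L) (c : E → L) : Prop :=
  ∀ B : Set E, IsBorelSet B → IsLUB (c '' B) (ν B)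

/-- Upper semicontinuity of a map into the poset. -/
def UscMap (c : E → L) : Prop := ∀ t : L, IsOpen {x : E | WayAbove t (c x)}

/-- Upper compactness of a map into the poset. -/
def UpperCompactMap (c : E → L) : Prop :=
  ∀ t : L, WayAbove t (⊥ : L) → IsCompact {x : E | ¬ WayAbove t (c x)}

/-- Continuity from above along decreasing sequences of Borel sets. -/
def ContinuousFromAbove (ν : Set E → L) : Prop :=
  ∀ B : ℕ → Set E, (∀ n, IsBorelSet (B n)) → (∀ n, B (n + 1) ⊆ B n) →
    IsGLB (Set.range fun n => ν (B n)) (ν (⋂ n, B n))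

/-- An optimal measure: a σ-maxitive measure continuous from above. -/
def OptimalMeasure (ν : Set E → L) : Prop :=
  SigmaMaxitive ν ∧ ContinuousFromAbove ν

/-- `flo` is the regular part `⌊ν⌋` (relative to `νp = ν⁺`):
`⌊ν⌋(B) = sup {ν⁺(K) : K compact Borel, K ⊆ B}`. -/
def RegPartRel (νp flo : Set E → L) : Prop :=
  ∀ B : Set E, IsBorelSet B →
    IsLUB {l : L | ∃ K : Set E, IsBorelSet K ∧ IsCompact K ∧ K ⊆ B ∧ νp K = l} (flo B)

end MeasDefs

section Saturation
variable {E : Type v} [TopologicalSpace E]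

theorem subset_satur (A : Set E) : A ⊆ satur A :=
  subset_sInter fun _ hG => hG.2

theorem satur_subset_of_isOpen {A G : Set E} (hG : IsOpen G) (h : A ⊆ G) : satur A ⊆ G :=
  sInter_subset_of_mem ⟨hG, h⟩

/-- A set squeezed between a compact set and its saturation is compact. -/
theorem IsCompact.of_subset_satur {K A : Set E} (hK : IsCompact K) (hKA : K ⊆ A)
    (hA : A ⊆ satur K) : IsCompact A := by
  refine isCompact_of_finite_subcover fun U hU hAU => ?_
  obtain ⟨t, ht⟩ := hK.elim_finite_subcover U hU (hKA.trans hAU)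
  exact ⟨t, hA.trans (satur_subset_of_isOpen (isOpen_biUnion fun i _ => hU i) ht)⟩

theorem IsOpen.isBorelSet {G : Set E} (hG : IsOpen G) : IsBorelSet G :=
  MeasurableSpace.measurableSet_generateFrom (Or.inl hG)

theorem IsCompact.isBorelSet_satur {K : Set E} (hK : IsCompact K) : IsBorelSet (satur K) :=
  MeasurableSpace.measurableSet_generateFrom
    (Or.inr ⟨hK.of_subset_satur (subset_satur K) subset_rfl, _, fun _ hG => hG.1, rfl⟩)

theorem mem_ptClass_self (x : E) : x ∈ ptClass x :=
  ⟨subset_satur _ rfl, subset_closure rfl⟩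

theorem isCompact_ptClass (x : E) : IsCompact (ptClass x) :=
  isCompact_singleton.of_subset_satur (singleton_subset_iff.2 (mem_ptClass_self x))
    inter_subset_left

theorem isBorelSet_ptClass (x : E) : IsBorelSet (ptClass x) := by
  have hc : IsBorelSet (closure {x})ᶜ := isClosed_closure.isOpen_compl.isBorelSet
  exact @MeasurableSet.inter E (BorelM E) _ _ isCompact_singleton.isBorelSet_satur
    (@MeasurableSet.of_compl E _ (BorelM E) hc)

theorem mem_iff_of_mem_ptClass {x y : E} (hy : y ∈ ptClass x) {G : Set E} (hG : IsOpen G) :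
    y ∈ G ↔ x ∈ G := by
  constructor
  · intro h
    obtain ⟨z, hz, rfl⟩ := mem_closure_iff.1 hy.2 G hG h
    exact hz
  · intro h
    exact satur_subset_of_isOpen hG (singleton_subset_iff.2 h) hy.1

/-- Borel sets do not separate topologically indistinguishable points. -/
theorem IsBorelSet.mem_iff_of_mem_ptClass {x y : E} (hy : y ∈ ptClass x) {B : Set E}
    (hB : IsBorelSet B) : y ∈ B ↔ x ∈ B := by
  refine MeasurableSpace.generateFrom_induction _ (fun B _ => y ∈ B ↔ x ∈ B) ?_ ?_ ?_ ?_ B hB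
  · rintro B (hB | ⟨-, 𝒢, h𝒢, rfl⟩) -
    · exact _root_.mem_iff_of_mem_ptClass hy hB
    · exact forall₂_congr fun G hG => _root_.mem_iff_of_mem_ptClass hy (h𝒢 G hG)
  · simp
  · intro B _ h
    exact not_congr h
  · intro f _ h
    simp only [mem_iUnion, h]

theorem IsBorelSet.ptClass_subset {x : E} {B : Set E} (hB : IsBorelSet B) (hx : x ∈ B) :
    ptClass x ⊆ B :=
  fun _ hy => (hB.mem_iff_of_mem_ptClass hy).2 hx

end Saturation

section WayAboveLemmas
variable {L : Type u} [PartialOrder L]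

theorem WayAbove.mono {s r t : L} (h : WayAbove s r) (htr : t ≤ r) : WayAbove s t :=
  fun F hF i hi hit => h F hF i hi (hit.trans htr)

theorem ContinuousPoset.le_of_forall_wayAbove (hL : ContinuousPoset L) {a b : L}
    (h : ∀ s, WayAbove s b → a ≤ s) : a ≤ b :=
  (hL b).2.2 h

end WayAboveLemmas

section MaxitiveMeasures
variable {L : Type u} {E : Type v} [PartialOrder L] [OrderBot L] [TopologicalSpace E]
  {ν : Set E → L}

theorem Maxitive.union_le (hν : Maxitive ν) {A B : Set E} (hA : IsBorelSet A)
    (hB : IsBorelSet B) {s : L} (hAs : ν A ≤ s) (hBs : ν B ≤ s) : ν (A ∪ B) ≤ s := by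
  have h := hν.2 {A, B} (toFinite _) (by rintro C (rfl | rfl) <;> assumption)
  rw [sUnion_pair] at h
  refine h.2 ?_
  rintro _ ⟨C, rfl | rfl, rfl⟩ <;> assumption

theorem Maxitive.mono (hν : Maxitive ν) {A B : Set E} (hA : IsBorelSet A)
    (hB : IsBorelSet B) (hAB : A ⊆ B) : ν A ≤ ν B := by
  have h := hν.2 {A, B} (toFinite _) (by rintro C (rfl | rfl) <;> assumption)
  rw [sUnion_pair, union_eq_self_of_subset_left hAB] at h
  exact h.1 (mem_image_of_mem ν (mem_insert A {B}))

/-- If `s` is way-above the infimum of the values of `ν` on open neighbourhoods of `B`, then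
some open neighbourhood of `B` has value below `s`. -/
theorem Maxitive.exists_isOpen_le (hν : Maxitive ν) {B : Set E} {i s : L}
    (hi : IsGLB (outerVals ν B) i) (hs : WayAbove s i) :
    ∃ G, IsOpen G ∧ B ⊆ G ∧ ν G ≤ s := by
  refine hs {l | ∃ G, IsOpen G ∧ B ⊆ G ∧ ν G ≤ l} ⟨⟨?_, ?_⟩, ?_⟩ i ⟨?_, ?_⟩ le_rfl
  · exact ⟨ν univ, univ, isOpen_univ, subset_univ B, le_rfl⟩
  · rintro r ⟨G, hG, hBG, hGr⟩ t ⟨H, hH, hBH, hHt⟩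
    have hGH := (hG.inter hH).isBorelSet
    exact ⟨ν (G ∩ H), ⟨G ∩ H, hG.inter hH, subset_inter hBG hBH, le_rfl⟩,
      (hν.mono hGH hG.isBorelSet inter_subset_left).trans hGr,
      (hν.mono hGH hH.isBorelSet inter_subset_right).trans hHt⟩
  · rintro r ⟨G, hG, hBG, hGr⟩ t hrt
    exact ⟨G, hG, hBG, hGr.trans hrt⟩
  · rintro l ⟨G, hG, hBG, hGl⟩
    exact (hi.1 ⟨G, hG, hBG, rfl⟩).trans hGl
  · intro b hb
    refine hi.2 ?_
    rintro _ ⟨G, hG, hBG, rfl⟩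
    exact hb ⟨G, hG, hBG, le_rfl⟩

theorem Maxitive.exists_isOpen_mem_le (hν : Maxitive ν) (hwoc : WeaklyOuterContinuous ν)
    {x : E} {s : L} (hs : WayAbove s (ν (ptClass x))) :
    ∃ G, IsOpen G ∧ x ∈ G ∧ ν G ≤ s := by
  obtain ⟨G, hG, hxG, hGs⟩ :=
    hν.exists_isOpen_le (hwoc _ (isBorelSet_ptClass x) (isCompact_ptClass x)) hs
  exact ⟨G, hG, hxG (mem_ptClass_self x), hGs⟩

theorem Maxitive.ptClass_le (hν : Maxitive ν) {x : E} {B : Set E} (hB : IsBorelSet B)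
    (hx : x ∈ B) : ν (ptClass x) ≤ ν B :=
  hν.mono (isBorelSet_ptClass x) hB (hB.ptClass_subset hx)

theorem Maxitive.le_of_isCompact (hL : ContinuousPoset L) (hν : Maxitive ν)
    (hwoc : WeaklyOuterContinuous ν) {K : Set E} (hK : IsBorelSet K) (hKc : IsCompact K)
    {m : L} (hm : ∀ x ∈ K, ν (ptClass x) ≤ m) : ν K ≤ m := by
  refine hL.le_of_forall_wayAbove fun s hs => ?_
  obtain ⟨G, hG, hKG, hGs⟩ : ∃ G, IsOpen G ∧ K ⊆ G ∧ ν G ≤ s := by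
    refine hKc.induction_on (p := fun A => ∃ G, IsOpen G ∧ A ⊆ G ∧ ν G ≤ s) ?_ ?_ ?_ ?_
    · exact ⟨∅, isOpen_empty, subset_rfl, hν.1.trans_le bot_le⟩
    · rintro A B hAB ⟨G, hG, hBG, hGs⟩
      exact ⟨G, hG, hAB.trans hBG, hGs⟩
    · rintro A B ⟨G, hG, hAG, hGs⟩ ⟨H, hH, hBH, hHs⟩
      exact ⟨G ∪ H, hG.union hH, union_subset_union hAG hBH,
        hν.union_le hG.isBorelSet hH.isBorelSet hGs hHs⟩
    · intro x hx
      obtain ⟨G, hG, hxG, hGs⟩ := hν.exists_isOpen_mem_le hwoc (hs.mono (hm x hx))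
      exact ⟨G, mem_nhdsWithin_of_mem_nhds (hG.mem_nhds hxG), G, hG, subset_rfl, hGs⟩
  exact (hν.mono hK hG.isBorelSet hKG).trans hGs

theorem Maxitive.le_of_isOpen (hL : ContinuousPoset L) {νp : Set E → L} (hν : Maxitive ν)
    (hνp : IsNuPlus ν νp) (hwoc : WeaklyOuterContinuous ν)
    (hwic : WeaklyInnerContinuous ν νp) {G : Set E} (hG : IsOpen G) {m : L}
    (hm : ∀ x ∈ G, ν (ptClass x) ≤ m) : ν G ≤ m := by
  refine (hwic G hG).2 ?_
  rintro _ ⟨K, hK, hKc, hKG, rfl⟩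
  rw [(hνp K hK).unique (hwoc K hK hKc)]
  exact hν.le_of_isCompact hL hwoc hK hKc fun x hx => hm x (hKG hx)

/-- Any lower bound of the values of `ν` on open neighbourhoods of `B` is below any upper bound
of the values of `ν` on the point classes of `B`. -/
theorem Maxitive.le_of_mem_lowerBounds_outerVals (hL : ContinuousPoset L) {νp : Set E → L}
    (hν : Maxitive ν) (hνp : IsNuPlus ν νp) (hwoc : WeaklyOuterContinuous ν)
    (hwic : WeaklyInnerContinuous ν νp) {B : Set E} {b m : L}
    (hb : b ∈ lowerBounds (outerVals ν B)) (hm : ∀ x ∈ B, ν (ptClass x) ≤ m) : b ≤ m := by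
  refine hL.le_of_forall_wayAbove fun s hs => ?_
  have key : ∀ x ∈ B, ∃ G, IsOpen G ∧ x ∈ G ∧ ν G ≤ s := fun x hx =>
    hν.exists_isOpen_mem_le hwoc (hs.mono (hm x hx))
  have hU : IsOpen (⋃₀ {G | IsOpen G ∧ ν G ≤ s}) := isOpen_sUnion fun G hG => hG.1
  refine (hb ⟨_, hU, fun x hx => ?_, rfl⟩).trans
    (hν.le_of_isOpen hL hνp hwoc hwic hU (m := s) ?_)
  · obtain ⟨G, hG, hxG, hGs⟩ := key x hx
    exact ⟨G, ⟨hG, hGs⟩, hxG⟩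
  · rintro y ⟨G, ⟨hG, hGs⟩, hyG⟩
    exact (hν.ptClass_le hG.isBorelSet hyG).trans hGs

theorem Maxitive.mem_lowerBounds_outerVals (hν : Maxitive ν) {B : Set E}
    (hB : IsBorelSet B) : ν B ∈ lowerBounds (outerVals ν B) := by
  rintro _ ⟨G, hG, hBG, rfl⟩
  exact hν.mono hB hG.isBorelSet hBG

/-- The values on point classes form a cardinal density. -/
theorem Maxitive.isCardinalDensity_ptClass (hL : ContinuousPoset L) {νp : Set E → L}
    (hν : Maxitive ν) (hνp : IsNuPlus ν νp) (hwoc : WeaklyOuterContinuous ν)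
    (hwic : WeaklyInnerContinuous ν νp) : IsCardinalDensity ν fun x => ν (ptClass x) := by
  refine fun B hB => ⟨?_, fun m hm => ?_⟩
  · rintro _ ⟨x, hx, rfl⟩
    exact hν.ptClass_le hB hx
  · exact hν.le_of_mem_lowerBounds_outerVals hL hνp hwoc hwic
      (hν.mem_lowerBounds_outerVals hB) fun x hx => hm ⟨x, hx, rfl⟩

theorem Maxitive.outerContinuous (hL : ContinuousPoset L) {νp : Set E → L}
    (hν : Maxitive ν) (hνp : IsNuPlus ν νp) (hwoc : WeaklyOuterContinuous ν)
    (hwic : WeaklyInnerContinuous ν νp) : OuterContinuous ν := fun _ hB =>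
  ⟨hν.mem_lowerBounds_outerVals hB, fun _ hb =>
    hν.le_of_mem_lowerBounds_outerVals hL hνp hwoc hwic hb fun _ hx => hν.ptClass_le hB hx⟩

/-- An outer-continuous maxitive measure with the point-class density is inner-continuous. -/
theorem Maxitive.innerContinuous (hν : Maxitive ν) (hout : OuterContinuous ν)
    (hc : IsCardinalDensity ν fun x => ν (ptClass x)) : InnerContinuous ν := by
  refine fun B hB => ⟨?_, fun m hm => (hc B hB).2 ?_⟩
  · rintro _ ⟨K, -, hKc, hKB, rfl⟩
    refine (hout B hB).2 ?_
    rintro _ ⟨G, hG, hBG, rfl⟩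
    exact hν.mono hKc.isBorelSet_satur hG.isBorelSet
      (satur_subset_of_isOpen hG (hKB.trans hBG))
  · rintro _ ⟨x, hx, rfl⟩
    have hxc := isCompact_ptClass x
    exact (hν.mono (isBorelSet_ptClass x) hxc.isBorelSet_satur (subset_satur _)).trans
      (hm ⟨_, isBorelSet_ptClass x, hxc, hB.ptClass_subset hx, rfl⟩)

theorem Maxitive.completelyMaxitive (hν : Maxitive ν) {c : E → L}
    (hc : IsCardinalDensity ν c) : CompletelyMaxitive ν := by
  refine ⟨hν, fun 𝒞 h𝒞 hU => ⟨?_, fun m hm => (hc _ hU).2 ?_⟩⟩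
  · rintro _ ⟨B, hB, rfl⟩
    exact hν.mono (h𝒞 B hB) hU (subset_sUnion_of_mem hB)
  · rintro _ ⟨x, ⟨B, hB, hx⟩, rfl⟩
    exact ((hc B (h𝒞 B hB)).1 ⟨x, hx, rfl⟩).trans (hm ⟨B, hB, rfl⟩)

end MaxitiveMeasures

/-- every maxitive measure that is both weakly outer-continuous and
weakly inner-continuous is regular and completely maxitive. -/
theorem stmt13 {L : Type u} {E : Type v} [PartialOrder L] [OrderBot L]
    [TopologicalSpace E] (hL : DomainPoset L)
    (ν νp : Set E → L) (hν : Maxitive ν) (hνp : IsNuPlus ν νp)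
    (hwoc : WeaklyOuterContinuous ν) (hwic : WeaklyInnerContinuous ν νp) :
    RegularMeasure ν ∧ CompletelyMaxitive ν := by
  have hc := hν.isCardinalDensity_ptClass hL.2 hνp hwoc hwic
  have hout := hν.outerContinuous hL.2 hνp hwoc hwic
  exact ⟨⟨hν.innerContinuous hout hc, hout⟩, hν.completelyMaxitive hc⟩
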